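/- Let u be real analytic on an open neighborhood of the origin in ℝ² with D²u(0,0) = λ·Id for some λ ∈ ℝ, and suppose u is not a polynomial of degree at most two. Let w be the lowest-degree non-zero homogeneous polynomial, of degree ≥ 3, in the Taylor expansion at the origin of u minus its second-order Taylor polynomial, and assume w is harmonic. Then there exists a punctured neighborhood of the origin on which (Δu)² − 4 det D²u > 0; in particular, the origin is an isolated point of the set of points where D²u is a scalar multiple of the identity. -/

import Mathlib

open Set Metric Topology Asymptotics MvPolynomial Matrix

/-- Partial derivative with respect to the first variable. -/
noncomputable def pdx (f : ℝ × ℝ → ℝ) (p : ℝ × ℝ) : ℝ :=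
  deriv (fun x => f (x, p.2)) p.1

/-- Partial derivative with respect to the second variable. -/
noncomputable def pdy (f : ℝ × ℝ → ℝ) (p : ℝ × ℝ) : ℝ :=
  deriv (fun y => f (p.1, y)) p.2

/-- The Laplacian `Δu = u_xx + u_yy`. -/
noncomputable def lap (f : ℝ × ℝ → ℝ) (p : ℝ × ℝ) : ℝ :=
  pdx (pdx f) p + pdy (pdy f) p

/-- The Hessian determinant `det D²u = u_xx u_yy - u_xy²`. -/
noncomputable def hessDet (f : ℝ × ℝ → ℝ) (p : ℝ × ℝ) : ℝ :=
  pdx (pdx f) p * pdy (pdy f) p - (pdx (pdy f) p) ^ 2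

/-- The Jacobian `J[f,g] = f_x g_y - f_y g_x`. -/
noncomputable def jacDet (f g : ℝ × ℝ → ℝ) (p : ℝ × ℝ) : ℝ :=
  pdx f p * pdy g p - pdy f p * pdx g p

/-- The diagonal of a continuous `n`-linear map vanishes if it is `o(‖y‖ ^ n)` at the origin. -/
theorem ContinuousMultilinearMap.apply_diag_eq_zero_of_isLittleO {E F : Type*}
    [NormedAddCommGroup E] [NormedSpace ℝ E] [NormedAddCommGroup F] [NormedSpace ℝ F] {n : ℕ}
    {p : ContinuousMultilinearMap ℝ (fun _ : Fin n => E) F}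
    (h : (fun y => p fun _ => y) =o[𝓝 0] fun y => ‖y‖ ^ n) (y : E) : (p fun _ => y) = 0 := by
  have ht : Filter.Tendsto (fun t : ℝ => t • y) (𝓝[≠] 0) (𝓝 0) := by
    have : Filter.Tendsto (fun t : ℝ => t • y) (𝓝 0) (𝓝 ((0 : ℝ) • y)) :=
      (continuous_id.smul continuous_const).tendsto 0
    rw [zero_smul] at this
    exact this.mono_left nhdsWithin_le_nhds
  rw [← norm_le_zero_iff]
  refine le_of_forall_pos_le_add fun ε hε => ?_
  have hc : 0 < ε / (‖y‖ ^ n + 1) := by positivity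
  obtain ⟨t, hle, hne⟩ := ((ht.eventually (h.def hc)).and self_mem_nhdsWithin).exists
  have hpos : 0 < |t| ^ n := pow_pos (abs_pos.mpr hne) n
  have hsmul : (p fun _ => t • y) = t ^ n • p fun _ => y := by
    simpa using p.map_smul_univ (fun _ => t) (fun _ => y)
  rw [hsmul, norm_smul, norm_pow, Real.norm_eq_abs, norm_pow, norm_norm, norm_smul,
    Real.norm_eq_abs, mul_pow] at hle
  have hle' : ‖p fun _ => y‖ ≤ ε / (‖y‖ ^ n + 1) * ‖y‖ ^ n :=
    le_of_mul_le_mul_left (by linarith) hpos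
  have : ε / (‖y‖ ^ n + 1) * ‖y‖ ^ n ≤ ε := by
    rw [div_mul_eq_mul_div, div_le_iff₀ (by positivity)]
    nlinarith
  linarith

/-- If `f = o(‖y‖ ^ n)` at the origin, the terms of order at most `n` of a power series of `f`
vanish on the diagonal. -/
theorem HasFPowerSeriesAt.apply_diag_eq_zero_of_isLittleO {E F : Type*}
    [NormedAddCommGroup E] [NormedSpace ℝ E] [NormedAddCommGroup F] [NormedSpace ℝ F] {n : ℕ}
    {f : E → F} {p : FormalMultilinearSeries ℝ E F} (hf : HasFPowerSeriesAt f p 0)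
    (h : f =o[𝓝 0] fun y => ‖y‖ ^ n) (k : ℕ) (hk : k ≤ n) (y : E) : (p k fun _ => y) = 0 := by
  induction k using Nat.strong_induction_on generalizing y with
  | _ k ih =>
    have hsum : ∀ y, p.partialSum (k + 1) y = p k fun _ => y := fun y => by
      rw [FormalMultilinearSeries.partialSum, Finset.sum_range_succ, Finset.sum_eq_zero, zero_add]
      intro i hi
      have hi := Finset.mem_range.mp hi
      exact ih i hi (by omega) y
    have hO := hf.isBigO_sub_partialSum_pow (k + 1)
    simp only [hsum, zero_add] at hO
    have hpow : (fun y : E => ‖y‖ ^ (k + 1)) =o[𝓝 0] fun y => ‖y‖ ^ k :=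
      isLittleO_norm_pow_norm_pow k.lt_succ_self
    have hpow' : (fun y : E => ‖y‖ ^ n) =O[𝓝 0] fun y => ‖y‖ ^ k := by
      rcases hk.eq_or_lt with rfl | hlt
      · exact isBigO_refl _ _
      · exact (isLittleO_norm_pow_norm_pow hlt).isBigO
    refine ContinuousMultilinearMap.apply_diag_eq_zero_of_isLittleO ?_ y
    simpa using (h.trans_isBigO hpow').sub (hO.trans_isLittleO hpow)

/-- Differentiation of an analytic function lowers the order of vanishing by at most one. -/
theorem AnalyticAt.fderiv_isLittleO {E F : Type*}
    [NormedAddCommGroup E] [NormedSpace ℝ E] [NormedAddCommGroup F] [NormedSpace ℝ F]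
    [CompleteSpace F] {n : ℕ} {f : E → F} (hf : AnalyticAt ℝ f 0)
    (h : f =o[𝓝 0] fun y => ‖y‖ ^ (n + 1)) : fderiv ℝ f =o[𝓝 0] fun y => ‖y‖ ^ n := by
  obtain ⟨p, r, hp⟩ := hf
  have hdiag := hp.hasFPowerSeriesAt.apply_diag_eq_zero_of_isLittleO h
  let q : FormalMultilinearSeries ℝ E F := fun k => if k < n + 2 then p k else 0
  have hq : HasFPowerSeriesOnBall (0 : E → F) q 0 r := by
    refine (HasFiniteFPowerSeriesOnBall.mk' (n := n + 2) (fun m hm => ?_) hp.r_pos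
      fun y _ => ?_).toHasFPowerSeriesOnBall
    · simp [q, hm]
    · refine Finset.sum_eq_zero fun i hi => ?_
      have hi := Finset.mem_range.mp hi
      simp only [q, hi, if_true]
      exact hdiag i (by omega) y
  have hpq := (hp.sub hq).fderiv
  rw [sub_zero] at hpq
  have hzero : ∀ k < n + 1, (p - q).derivSeries k = 0 := by
    intro k hk
    have hk' : (p - q) (1 + k) = 0 := by
      change p (1 + k) - q (1 + k) = 0
      simp [q, show 1 + k < n + 2 by omega]
    simp only [FormalMultilinearSeries.derivSeries,
      ContinuousLinearMap.compFormalMultilinearSeries_apply,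
      FormalMultilinearSeries.changeOriginSeries, FormalMultilinearSeries.changeOriginSeriesTerm,
      hk']
    ext
    simp
  have hO := hpq.hasFPowerSeriesAt.isBigO_sub_partialSum_pow (n + 1)
  have hsum : ∀ y, (p - q).derivSeries.partialSum (n + 1) y = 0 := fun y =>
    Finset.sum_eq_zero fun i hi => by rw [hzero i (Finset.mem_range.mp hi)]; rfl
  simp only [hsum, zero_add, sub_zero] at hO
  exact hO.trans_isLittleO (isLittleO_norm_pow_norm_pow n.lt_succ_self)

theorem pdx_eq_fderiv {f : ℝ × ℝ → ℝ} {p : ℝ × ℝ} (hf : DifferentiableAt ℝ f p) :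
    pdx f p = fderiv ℝ f p (1, 0) :=
  (hf.hasFDerivAt.comp_hasDerivAt p.1 ((hasDerivAt_id p.1).prodMk (hasDerivAt_const p.1 p.2))).deriv

theorem pdy_eq_fderiv {f : ℝ × ℝ → ℝ} {p : ℝ × ℝ} (hf : DifferentiableAt ℝ f p) :
    pdy f p = fderiv ℝ f p (0, 1) :=
  (hf.hasFDerivAt.comp_hasDerivAt p.2 ((hasDerivAt_const p.2 p.1).prodMk (hasDerivAt_id p.2))).deriv

theorem AnalyticAt.pdx_eventuallyEq {f : ℝ × ℝ → ℝ} {p : ℝ × ℝ} (hf : AnalyticAt ℝ f p) :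
    pdx f =ᶠ[𝓝 p] fun q => fderiv ℝ f q (1, 0) :=
  hf.eventually_analyticAt.mono fun _ hq => pdx_eq_fderiv hq.differentiableAt

theorem AnalyticAt.pdy_eventuallyEq {f : ℝ × ℝ → ℝ} {p : ℝ × ℝ} (hf : AnalyticAt ℝ f p) :
    pdy f =ᶠ[𝓝 p] fun q => fderiv ℝ f q (0, 1) :=
  hf.eventually_analyticAt.mono fun _ hq => pdy_eq_fderiv hq.differentiableAt

theorem AnalyticAt.pdx {f : ℝ × ℝ → ℝ} {p : ℝ × ℝ} (hf : AnalyticAt ℝ f p) :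
    AnalyticAt ℝ (pdx f) p :=
  (((ContinuousLinearMap.apply ℝ ℝ ((1, 0) : ℝ × ℝ)).analyticAt _).comp hf.fderiv).congr
    hf.pdx_eventuallyEq.symm

theorem AnalyticAt.pdy {f : ℝ × ℝ → ℝ} {p : ℝ × ℝ} (hf : AnalyticAt ℝ f p) :
    AnalyticAt ℝ (pdy f) p :=
  (((ContinuousLinearMap.apply ℝ ℝ ((0, 1) : ℝ × ℝ)).analyticAt _).comp hf.fderiv).congr
    hf.pdy_eventuallyEq.symm

theorem AnalyticAt.fderiv_apply_isLittleO {f : ℝ × ℝ → ℝ} {n : ℕ} (hf : AnalyticAt ℝ f 0)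
    (h : f =o[𝓝 0] fun p => ‖p‖ ^ (n + 1)) (v : ℝ × ℝ) :
    (fun q => fderiv ℝ f q v) =o[𝓝 0] fun p => ‖p‖ ^ n :=
  (((ContinuousLinearMap.apply ℝ ℝ v).isBigO_comp (fderiv ℝ f) _)).trans_isLittleO
    (hf.fderiv_isLittleO h)

theorem AnalyticAt.pdx_isLittleO {f : ℝ × ℝ → ℝ} {n : ℕ} (hf : AnalyticAt ℝ f 0)
    (h : f =o[𝓝 0] fun p => ‖p‖ ^ (n + 1)) : _root_.pdx f =o[𝓝 0] fun p => ‖p‖ ^ n :=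
  (hf.fderiv_apply_isLittleO h (1, 0)).congr' hf.pdx_eventuallyEq.symm .rfl

theorem AnalyticAt.pdy_isLittleO {f : ℝ × ℝ → ℝ} {n : ℕ} (hf : AnalyticAt ℝ f 0)
    (h : f =o[𝓝 0] fun p => ‖p‖ ^ (n + 1)) : _root_.pdy f =o[𝓝 0] fun p => ‖p‖ ^ n :=
  (hf.fderiv_apply_isLittleO h (0, 1)).congr' hf.pdy_eventuallyEq.symm .rfl

theorem Filter.EventuallyEq.pdx_eq {f g : ℝ × ℝ → ℝ} {p : ℝ × ℝ} (h : f =ᶠ[𝓝 p] g) :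
    pdx f p = pdx g p :=
  Filter.EventuallyEq.deriv_eq <|
    (show Filter.Tendsto (fun x => (x, p.2)) (𝓝 p.1) (𝓝 p) from
      (Continuous.prodMk_left p.2).tendsto p.1).eventually h

theorem Filter.EventuallyEq.pdy_eq {f g : ℝ × ℝ → ℝ} {p : ℝ × ℝ} (h : f =ᶠ[𝓝 p] g) :
    pdy f p = pdy g p :=
  Filter.EventuallyEq.deriv_eq <|
    (show Filter.Tendsto (fun y => (p.1, y)) (𝓝 p.2) (𝓝 p) from
      (Continuous.prodMk_right p.1).tendsto p.2).eventually h

/-- A polynomial in two variables as a function on the plane. -/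
noncomputable def planeEval (P : MvPolynomial (Fin 2) ℝ) (p : ℝ × ℝ) : ℝ :=
  MvPolynomial.eval ![p.1, p.2] P

theorem hasDerivAt_planeEval_fst (P : MvPolynomial (Fin 2) ℝ) (x y : ℝ) :
    HasDerivAt (fun x => planeEval P (x, y)) (planeEval (pderiv 0 P) (x, y)) x := by
  unfold planeEval
  induction P using MvPolynomial.induction_on with
  | C a => simpa using hasDerivAt_const x a
  | add p q hp hq => simpa using hp.fun_add hq
  | mul_X p i hp =>
    fin_cases i
    · simpa [pderiv_X, Pi.single_apply, Derivation.leibniz, add_comm, mul_comm] using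
        hp.fun_mul (hasDerivAt_id' x)
    · simpa [pderiv_X, Pi.single_apply, Derivation.leibniz, mul_comm] using
        hp.fun_mul (hasDerivAt_const x y)

theorem hasDerivAt_planeEval_snd (P : MvPolynomial (Fin 2) ℝ) (x y : ℝ) :
    HasDerivAt (fun y => planeEval P (x, y)) (planeEval (pderiv 1 P) (x, y)) y := by
  unfold planeEval
  induction P using MvPolynomial.induction_on with
  | C a => simpa using hasDerivAt_const y a
  | add p q hp hq => simpa using hp.fun_add hq
  | mul_X p i hp =>
    fin_cases i
    · simpa [pderiv_X, Pi.single_apply, Derivation.leibniz, mul_comm] using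
        hp.fun_mul (hasDerivAt_const y x)
    · simpa [pderiv_X, Pi.single_apply, Derivation.leibniz, add_comm, mul_comm] using
        hp.fun_mul (hasDerivAt_id' y)

theorem pdx_planeEval (P : MvPolynomial (Fin 2) ℝ) :
    pdx (planeEval P) = planeEval (pderiv 0 P) :=
  funext fun p => (hasDerivAt_planeEval_fst P p.1 p.2).deriv

theorem pdy_planeEval (P : MvPolynomial (Fin 2) ℝ) :
    pdy (planeEval P) = planeEval (pderiv 1 P) :=
  funext fun p => (hasDerivAt_planeEval_snd P p.1 p.2).deriv

theorem analyticAt_planeEval (P : MvPolynomial (Fin 2) ℝ) (p : ℝ × ℝ) :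
    AnalyticAt ℝ (planeEval P) p := by
  have h := AnalyticAt.aeval_mvPolynomial (𝕜 := ℝ) (f := fun q : ℝ × ℝ => ![q.1, q.2]) (z := p)
    (fun i => by
      fin_cases i
      · exact analyticAt_fst
      · exact analyticAt_snd) P
  simp only [MvPolynomial.aeval_eq_eval] at h
  exact h

theorem pdx_eventuallyEq_add_planeEval {f g : ℝ × ℝ → ℝ} {P : MvPolynomial (Fin 2) ℝ}
    (hf : AnalyticAt ℝ f 0) (h : g =ᶠ[𝓝 0] f + planeEval P) :
    pdx g =ᶠ[𝓝 0] pdx f + planeEval (pderiv 0 P) := by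
  filter_upwards [h.eventuallyEq_nhds, hf.eventually_analyticAt] with p hp hfp
  have hP := (analyticAt_planeEval P p).differentiableAt
  rw [hp.pdx_eq, pdx_eq_fderiv (hfp.differentiableAt.add hP),
    fderiv_add hfp.differentiableAt hP, Pi.add_apply, ← pdx_planeEval,
    pdx_eq_fderiv hfp.differentiableAt, pdx_eq_fderiv hP, _root_.add_apply]

theorem pdy_eventuallyEq_add_planeEval {f g : ℝ × ℝ → ℝ} {P : MvPolynomial (Fin 2) ℝ}
    (hf : AnalyticAt ℝ f 0) (h : g =ᶠ[𝓝 0] f + planeEval P) :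
    pdy g =ᶠ[𝓝 0] pdy f + planeEval (pderiv 1 P) := by
  filter_upwards [h.eventuallyEq_nhds, hf.eventually_analyticAt] with p hp hfp
  have hP := (analyticAt_planeEval P p).differentiableAt
  rw [hp.pdy_eq, pdy_eq_fderiv (hfp.differentiableAt.add hP),
    fderiv_add hfp.differentiableAt hP, Pi.add_apply, ← pdy_planeEval,
    pdy_eq_fderiv hfp.differentiableAt, pdy_eq_fderiv hP, _root_.add_apply]

theorem planeEval_smul {P : MvPolynomial (Fin 2) ℝ} {n : ℕ} (hP : P.IsHomogeneous n) (t : ℝ)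
    (p : ℝ × ℝ) : planeEval P (t • p) = t ^ n * planeEval P p := by
  simp only [planeEval, MvPolynomial.eval_eq', Finset.mul_sum]
  refine Finset.sum_congr rfl fun s hs => ?_
  have hdeg : s 0 + s 1 = n := by
    rw [← hP (mem_support_iff.mp hs), Finsupp.weight_apply, Finsupp.sum_fintype _ _ (by simp)]
    simp
  simp only [Fin.prod_univ_two, ← hdeg, pow_add, Matrix.cons_val_zero, Matrix.cons_val_one,
    Prod.smul_fst, Prod.smul_snd, smul_eq_mul, mul_pow]
  ring

/-- Euler's identity for homogeneous polynomials in two variables. -/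
theorem planeEval_euler {P : MvPolynomial (Fin 2) ℝ} {n : ℕ} (hP : P.IsHomogeneous n)
    (p : ℝ × ℝ) :
    p.1 * planeEval (pderiv 0 P) p + p.2 * planeEval (pderiv 1 P) p = n * planeEval P p := by
  have h := congrArg (MvPolynomial.eval ![p.1, p.2]) hP.sum_X_mul_pderiv
  simpa [planeEval, Fin.sum_univ_two] using h

theorem eq_zero_of_planeEval_eq_zero {P : MvPolynomial (Fin 2) ℝ}
    (h : ∀ p, planeEval P p = 0) : P = 0 := by
  refine MvPolynomial.funext fun x => ?_
  have hx : x = ![x 0, x 1] := by ext i; fin_cases i <;> rfl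
  rw [hx, map_zero]
  exact h (x 0, x 1)

theorem eq_zero_of_pderiv_eq_zero {P : MvPolynomial (Fin 2) ℝ} {n : ℕ}
    (hP : P.IsHomogeneous (n + 1)) (h0 : pderiv 0 P = 0) (h1 : pderiv 1 P = 0) : P = 0 := by
  refine eq_zero_of_planeEval_eq_zero fun p => ?_
  have h := planeEval_euler hP p
  rw [h0, h1] at h
  simp only [planeEval, map_zero, mul_zero, add_zero] at h
  exact (mul_eq_zero.mp h.symm).resolve_left (by positivity)

theorem pderiv_pderiv_comm (P : MvPolynomial (Fin 2) ℝ) (i j : Fin 2) :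
    pderiv i (pderiv j P) = pderiv j (pderiv i P) := by
  have h : ⁅pderiv (R := ℝ) i, pderiv (R := ℝ) j⁆ = 0 := by
    refine MvPolynomial.derivation_ext fun k => ?_
    simp only [Derivation.commutator_apply, pderiv_X, Pi.single_apply, Derivation.coe_zero,
      Pi.zero_apply]
    split_ifs <;> simp
  have h' := DFunLike.congr_fun h P
  rw [Derivation.commutator_apply] at h'
  exact sub_eq_zero.mp h'

/-- If the second derivatives `P_xx`, `P_xy` of a harmonic homogeneous polynomial vanish at a
point other than the origin, then so do its first derivatives. -/
theorem planeEval_pderiv_eq_zero {P : MvPolynomial (Fin 2) ℝ} {n : ℕ}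
    (hP : P.IsHomogeneous (n + 2))
    (hharm : pderiv 0 (pderiv 0 P) + pderiv 1 (pderiv 1 P) = 0) {p : ℝ × ℝ}
    (hxx : planeEval (pderiv 0 (pderiv 0 P)) p = 0)
    (hxy : planeEval (pderiv 0 (pderiv 1 P)) p = 0) (i : Fin 2) :
    planeEval (pderiv i P) p = 0 := by
  have hyy : planeEval (pderiv 1 (pderiv 1 P)) p = 0 := by
    have := congrArg (planeEval · p) hharm
    simp only [planeEval, map_add, map_zero] at this hxx ⊢
    linarith
  have hyx : planeEval (pderiv 1 (pderiv 0 P)) p = 0 := by rwa [pderiv_pderiv_comm]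
  have h := planeEval_euler (n := n + 1) (hP.pderiv (i := i)) p
  have hn : ((n + 1 : ℕ) : ℝ) ≠ 0 := by positivity
  fin_cases i
  · simp only [Fin.zero_eta, hxx, hyx, mul_zero, add_zero] at h ⊢
    exact (mul_eq_zero.mp h.symm).resolve_left hn
  · simp only [Fin.mk_one, hxy, hyy, mul_zero, add_zero] at h ⊢
    exact (mul_eq_zero.mp h.symm).resolve_left hn

/-- A harmonic homogeneous polynomial of positive degree whose gradient vanishes at a point other
than the origin is zero. -/
theorem eq_zero_of_gradient_eq_zero {n : ℕ} {P : MvPolynomial (Fin 2) ℝ}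
    (hP : P.IsHomogeneous (n + 1))
    (hharm : pderiv 0 (pderiv 0 P) + pderiv 1 (pderiv 1 P) = 0) {p : ℝ × ℝ} (hp : p ≠ 0)
    (hx : planeEval (pderiv 0 P) p = 0) (hy : planeEval (pderiv 1 P) p = 0) : P = 0 := by
  induction n generalizing P with
  | zero =>
    have hconst : ∀ i, planeEval (pderiv i P) p = 0 → pderiv i P = 0 := fun i hi => by
      have hdeg : (pderiv i P).IsHomogeneous 0 := hP.pderiv
      rw [← totalDegree_zero_iff_isHomogeneous] at hdeg
      have hc := totalDegree_eq_zero_iff_eq_C.mp hdeg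
      rw [hc, planeEval, eval_C] at hi
      rw [hc, hi, map_zero]
    exact eq_zero_of_pderiv_eq_zero hP (hconst 0 hx) (hconst 1 hy)
  | succ n ih =>
    have hyx := pderiv_pderiv_comm P 1 0
    have hh : planeEval (pderiv 1 (pderiv 1 P)) p = - planeEval (pderiv 0 (pderiv 0 P)) p := by
      have := congrArg (planeEval · p) hharm
      simp only [planeEval, map_add, map_zero] at this ⊢
      linarith
    have e0 := planeEval_euler (hP.pderiv (i := 0)) p
    have e1 := planeEval_euler (hP.pderiv (i := 1)) p
    rw [hyx, hx, mul_zero] at e0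
    rw [hh, hy, mul_zero] at e1
    set A := planeEval (pderiv 0 (pderiv 0 P)) p with hA
    set B := planeEval (pderiv 0 (pderiv 1 P)) p with hB
    have hr : 0 < p.1 ^ 2 + p.2 ^ 2 := by
      by_contra! hle
      refine hp (Prod.ext ?_ ?_) <;> simp <;> nlinarith [sq_nonneg p.1, sq_nonneg p.2]
    have hA0 : A = 0 := by
      have : (p.1 ^ 2 + p.2 ^ 2) * A = 0 := by linear_combination p.1 * e0 - p.2 * e1
      exact (mul_eq_zero.mp this).resolve_left hr.ne'
    have hB0 : B = 0 := by
      have : (p.1 ^ 2 + p.2 ^ 2) * B = 0 := by linear_combination p.2 * e0 + p.1 * e1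
      exact (mul_eq_zero.mp this).resolve_left hr.ne'
    have hharm' : ∀ i, pderiv 0 (pderiv 0 (pderiv i P)) + pderiv 1 (pderiv 1 (pderiv i P)) = 0 := by
      intro i
      rw [pderiv_pderiv_comm P 0 i, pderiv_pderiv_comm P 1 i, pderiv_pderiv_comm _ 0 i,
        pderiv_pderiv_comm _ 1 i, ← map_add, hharm, map_zero]
    refine eq_zero_of_pderiv_eq_zero hP (ih (hP.pderiv (i := 0)) (hharm' 0) ?_ ?_)
      (ih (hP.pderiv (i := 1)) (hharm' 1) ?_ ?_)
    · exact hA0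
    · rw [hyx]; exact hB0
    · exact hB0
    · rw [hh, hA0, neg_zero]

/-- The Hessian of a non-zero harmonic homogeneous polynomial is bounded below by its expected
order. -/
theorem exists_hessian_lower_bound {n : ℕ} {P : MvPolynomial (Fin 2) ℝ} (hP0 : P ≠ 0)
    (hP : P.IsHomogeneous (n + 2))
    (hharm : pderiv 0 (pderiv 0 P) + pderiv 1 (pderiv 1 P) = 0) :
    ∃ c > 0, ∀ p, c * (‖p‖ ^ n) ^ 2 ≤ planeEval (pderiv 0 (pderiv 0 P)) p ^ 2 +
      planeEval (pderiv 0 (pderiv 1 P)) p ^ 2 := by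
  set A := pderiv 0 (pderiv 0 P)
  set B := pderiv 0 (pderiv 1 P)
  have hA : A.IsHomogeneous n := hP.pderiv.pderiv
  have hB : B.IsHomogeneous n := hP.pderiv.pderiv
  have hcont : ∀ Q, Continuous (planeEval Q) := fun Q =>
    continuous_iff_continuousAt.mpr fun p => (analyticAt_planeEval Q p).continuousAt
  obtain ⟨q, hq, hmin⟩ := (isCompact_sphere (0 : ℝ × ℝ) 1).exists_isMinOn
    (NormedSpace.sphere_nonempty.mpr zero_le_one)
    (((hcont A).pow 2).add ((hcont B).pow 2)).continuousOn
  have hq0 : q ≠ 0 := by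
    rintro rfl
    simp at hq
  refine ⟨planeEval A q ^ 2 + planeEval B q ^ 2, ?_, fun p => ?_⟩
  · by_contra! hle
    have hAq : planeEval A q = 0 := by nlinarith [sq_nonneg (planeEval A q), sq_nonneg (planeEval B q)]
    have hBq : planeEval B q = 0 := by nlinarith [sq_nonneg (planeEval A q), sq_nonneg (planeEval B q)]
    have hgrad := planeEval_pderiv_eq_zero hP hharm hAq hBq
    exact hP0 (eq_zero_of_gradient_eq_zero hP hharm hq0 (hgrad 0) (hgrad 1))
  · have hpq : ∃ s ∈ sphere (0 : ℝ × ℝ) 1, p = ‖p‖ • s := by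
      rcases eq_or_ne p 0 with rfl | hp
      · exact ⟨q, hq, by simp⟩
      · exact ⟨‖p‖⁻¹ • p, by simp [norm_smul, hp], by simp [smul_smul, hp]⟩
    obtain ⟨s, hs, hps⟩ := hpq
    have hms : planeEval A q ^ 2 + planeEval B q ^ 2 ≤ planeEval A s ^ 2 + planeEval B s ^ 2 :=
      hmin hs
    have hAp : planeEval A p = ‖p‖ ^ n * planeEval A s := by
      rw [← planeEval_smul hA, ← hps]
    have hBp : planeEval B p = ‖p‖ ^ n * planeEval B s := by
      rw [← planeEval_smul hB, ← hps]
    rw [hAp, hBp]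
    nlinarith [mul_le_mul_of_nonneg_right hms (sq_nonneg (‖p‖ ^ n))]

/-- A symmetric matrix with distinct eigenvalues keeps them distinct under a perturbation that is
small compared with its trace-free part, here with entries `A`, `B`, `-A`. -/
theorem discriminant_pos_of_perturbation {A B K l e₁ e₂ e₃ : ℝ} (hK : 0 < K)
    (hAB : K ≤ A ^ 2 + B ^ 2) (h₁₂ : (e₁ - e₂) ^ 2 ≤ K / 4) (h₃ : e₃ ^ 2 ≤ K / 4) :
    0 < (e₁ + (l + A) + (e₂ + (l + -A))) ^ 2 -
      4 * ((e₁ + (l + A)) * (e₂ + (l + -A)) - (e₃ + B) ^ 2) := by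
  have hdisc : (e₁ + (l + A) + (e₂ + (l + -A))) ^ 2 -
      4 * ((e₁ + (l + A)) * (e₂ + (l + -A)) - (e₃ + B) ^ 2) =
      (2 * A + (e₁ - e₂)) ^ 2 + 4 * (e₃ + B) ^ 2 := by ring
  rw [hdisc]
  have hA : 4 * A ^ 2 ≤ 2 * (2 * A + (e₁ - e₂)) ^ 2 + 2 * (e₁ - e₂) ^ 2 := by
    linarith [sq_nonneg (2 * A + 2 * (e₁ - e₂))]
  have hB : B ^ 2 ≤ 2 * (e₃ + B) ^ 2 + 2 * e₃ ^ 2 := by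
    linarith [sq_nonneg (2 * e₃ + B)]
  linarith

/-- If `u` is real analytic near the origin, `D²u(0,0) = λ·Id`, `u` is not a polynomial of
degree at most two, and the lowest-degree non-zero homogeneous term `w` (of degree `≥ 3`)
of `u` minus its second-order Taylor polynomial is harmonic, then
`(Δu)² − 4 det D²u > 0` on a punctured neighborhood of the origin; in particular the
origin is isolated among points where `D²u` is a scalar multiple of the identity. -/
theorem isolated_umbilic_case_C1
    (u : ℝ × ℝ → ℝ) (V : Set (ℝ × ℝ)) (hVopen : IsOpen V) (hV0 : (0, 0) ∈ V)
    (hu : AnalyticOnNhd ℝ u V)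
    -- `D²u(0,0) = λ·Id`
    (l : ℝ) (hH11 : pdx (pdx u) (0, 0) = l) (hH22 : pdy (pdy u) (0, 0) = l)
    (hH12 : pdx (pdy u) (0, 0) = 0) (hH21 : pdy (pdx u) (0, 0) = 0)
    -- `u` is not a polynomial of degree at most two
    (hnp : ¬∃ P : MvPolynomial (Fin 2) ℝ, P.totalDegree ≤ 2 ∧
      ∀ p ∈ V, u p = MvPolynomial.eval ![p.1, p.2] P)
    -- the lowest-degree non-zero homogeneous Taylor term `w` of `u` minus its 2-jet,
    -- of degree `d ≥ 3`, is harmonic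
    (d : ℕ) (hd : 3 ≤ d)
    (w : MvPolynomial (Fin 2) ℝ) (hw : w ≠ 0) (hwhom : w.IsHomogeneous d)
    (hwharm : ∀ p : ℝ × ℝ,
      lap (fun q : ℝ × ℝ => MvPolynomial.eval ![q.1, q.2] w) p = 0)
    (c₀ a b : ℝ)
    (ho : (fun p : ℝ × ℝ => u p - (c₀ + a * p.1 + b * p.2 + l / 2 * (p.1 ^ 2 + p.2 ^ 2)
        + MvPolynomial.eval ![p.1, p.2] w))
      =o[𝓝 ((0, 0) : ℝ × ℝ)] fun p => ‖p‖ ^ d) :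
    ∃ ε : ℝ, 0 < ε ∧ ∀ p : ℝ × ℝ, p ≠ (0, 0) → p.1 ^ 2 + p.2 ^ 2 < ε ^ 2 →
      (lap u p) ^ 2 - 4 * hessDet u p > 0 ∧
      ¬∃ μ : ℝ, pdx (pdx u) p = μ ∧ pdy (pdy u) p = μ ∧
        pdx (pdy u) p = 0 ∧ pdy (pdx u) p = 0 := by
  obtain ⟨n, rfl⟩ : ∃ n, d = n + 2 := ⟨d - 2, by omega⟩
  let T : MvPolynomial (Fin 2) ℝ :=
    C c₀ + C a * X 0 + C b * X 1 + C (l / 2) * (X 0 * X 0 + X 1 * X 1) + w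
  let R : ℝ × ℝ → ℝ := u - planeEval T
  have hRan : AnalyticAt ℝ R 0 := (hu 0 hV0).sub (analyticAt_planeEval T 0)
  have hRo : R =o[𝓝 0] fun p => ‖p‖ ^ (n + 2) := by
    refine ho.congr_left fun p => ?_
    simp [R, T, planeEval, sq]
  have huR : u =ᶠ[𝓝 0] R + planeEval T := by simp [R]
  have hw' : pderiv 0 (pderiv 0 w) + pderiv 1 (pderiv 1 w) = 0 := by
    refine eq_zero_of_planeEval_eq_zero fun p => ?_
    have h := hwharm p
    change lap (planeEval w) p = 0 at h
    rw [lap, pdx_planeEval, pdx_planeEval, pdy_planeEval, pdy_planeEval] at h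
    simpa [planeEval] using h
  have hxx := pdx_eventuallyEq_add_planeEval hRan.pdx (pdx_eventuallyEq_add_planeEval hRan huR)
  have hyy := pdy_eventuallyEq_add_planeEval hRan.pdy (pdy_eventuallyEq_add_planeEval hRan huR)
  have hxy := pdx_eventuallyEq_add_planeEval hRan.pdy (pdy_eventuallyEq_add_planeEval hRan huR)
  have hTxx : ∀ p, planeEval (pderiv 0 (pderiv 0 T)) p =
      l + planeEval (pderiv 0 (pderiv 0 w)) p := fun p => by
    simp [T, planeEval, pderiv_X, Derivation.leibniz]
    ring
  have hTyy : ∀ p, planeEval (pderiv 1 (pderiv 1 T)) p =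
      l + planeEval (pderiv 1 (pderiv 1 w)) p := fun p => by
    simp [T, planeEval, pderiv_X, Derivation.leibniz]
    ring
  have hTxy : ∀ p, planeEval (pderiv 0 (pderiv 1 T)) p =
      planeEval (pderiv 0 (pderiv 1 w)) p := fun p => by
    simp [T, planeEval, pderiv_X, Derivation.leibniz]
  obtain ⟨c, hc, hbound⟩ := exists_hessian_lower_bound hw hwhom hw'
  have hδ : 0 < √(c / 4) := by positivity
  have hδsq : √(c / 4) ^ 2 = c / 4 := Real.sq_sqrt (by positivity)
  have hRdiff := ((hRan.pdx.pdx_isLittleO (hRan.pdx_isLittleO hRo)).sub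
    (hRan.pdy.pdy_isLittleO (hRan.pdy_isLittleO hRo))).def hδ
  have hRxy := (hRan.pdy.pdx_isLittleO (hRan.pdy_isLittleO hRo)).def hδ
  have hpos : ∀ᶠ p in 𝓝 (0 : ℝ × ℝ), p ≠ 0 → lap u p ^ 2 - 4 * hessDet u p > 0 := by
    filter_upwards [hxx, hyy, hxy, hRdiff, hRxy] with p hxx hyy hxy hd1 hd2 hp
    rw [Pi.add_apply, hTxx] at hxx
    rw [Pi.add_apply, hTyy] at hyy
    rw [Pi.add_apply, hTxy] at hxy
    have hh : planeEval (pderiv 0 (pderiv 0 w)) p + planeEval (pderiv 1 (pderiv 1 w)) p = 0 := by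
      simpa [planeEval] using congrArg (planeEval · p) hw'
    rw [lap, hessDet, hxx, hyy, hxy]
    have hb := hbound p
    have hr : 0 < ‖p‖ ^ n := pow_pos (norm_pos_iff.mpr hp) n
    rw [norm_pow, norm_norm, Real.norm_eq_abs] at hd1 hd2
    have hs1 := sq_le_sq' (abs_le.mp hd1).1 (abs_le.mp hd1).2
    have hs2 := sq_le_sq' (abs_le.mp hd2).1 (abs_le.mp hd2).2
    rw [mul_pow, hδsq] at hs1 hs2
    rw [eq_neg_of_add_eq_zero_right hh]
    exact discriminant_pos_of_perturbation (by positivity) hb (by linarith) (by linarith)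
  obtain ⟨ε, hε, hball⟩ := Metric.eventually_nhds_iff.mp hpos
  refine ⟨ε, hε, fun p hp hlt => ?_⟩
  have hnorm : dist p 0 < ε := by
    rw [dist_zero_right, Prod.norm_def, max_lt_iff, Real.norm_eq_abs, Real.norm_eq_abs]
    constructor <;> refine abs_lt_of_sq_lt_sq ?_ hε.le <;>
      nlinarith [sq_nonneg p.1, sq_nonneg p.2]
  have hp' := hball hnorm hp
  refine ⟨hp', ?_⟩
  rintro ⟨μ, h11, h22, h12, -⟩
  rw [lap, hessDet, h11, h22, h12] at hp'
  linarith
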